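/- Suppose the induced subdigraph D[V(P)] is a semicomplete digraph. Then for any x ∈ V(D)∖V(P) and any vertex x_i of P: if x→x_i is an arc, then x is adjacent to every vertex of {x_0, x_1, …, x_{i−1}}; if x_i→x is an arc, then x is adjacent to every vertex of {x_{i+1}, x_{i+2}, …, x_{k+2}}. -/

import Mathlib

variable {V : Type*}

/-- Two vertices are adjacent in the digraph with arc relation `A`. -/
def DAdj (A : V → V → Prop) (x y : V) : Prop := A x y ∨ A y x

/-- `x 0, x 1, …, x n` is a directed path of length `n` (distinct vertices, consecutive arcs). -/
def IsDipathOn (A : V → V → Prop) (n : ℕ) (x : ℕ → V) : Prop :=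
  (∀ i j, i ≤ n → j ≤ n → x i = x j → i = j) ∧ ∀ i, i < n → A (x i) (x (i + 1))

/-- There is a directed path of length `n` from `u` to `v`. -/
def HasDipath (A : V → V → Prop) (n : ℕ) (u v : V) : Prop :=
  ∃ x : ℕ → V, IsDipathOn A n x ∧ x 0 = u ∧ x n = v

/-- A digraph is `k`-quasi-transitive if the endpoints of every path of length `k` are adjacent. -/
def KQuasiTransitive (A : V → V → Prop) (k : ℕ) : Prop :=
  ∀ x : ℕ → V, IsDipathOn A k x → DAdj A (x 0) (x k)

/-- A digraph is strong if every vertex is reachable from every other vertex. -/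
def StrongD (A : V → V → Prop) : Prop := ∀ u v : V, ∃ n, HasDipath A n u v

/-- The subdigraph induced on `S` is semicomplete. -/
def SemicompleteOn (A : V → V → Prop) (S : Set V) : Prop :=
  ∀ x ∈ S, ∀ y ∈ S, x ≠ y → DAdj A x y

/-- The subdigraph induced on `S` is semicomplete bipartite. -/
def SemicompleteBipartiteOn (A : V → V → Prop) (S : Set V) : Prop :=
  ∃ X Y : Set V, X ∪ Y = S ∧ X ∩ Y = ∅ ∧
    (∀ x ∈ X, ∀ y ∈ X, ¬ DAdj A x y) ∧
    (∀ x ∈ Y, ∀ y ∈ Y, ¬ DAdj A x y) ∧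
    (∀ x ∈ X, ∀ y ∈ Y, DAdj A x y)

/-- The subdigraph induced on `S` has no arcs. -/
def EmptyOn (A : V → V → Prop) (S : Set V) : Prop :=
  ∀ x ∈ S, ∀ y ∈ S, ¬ A x y

/-- The vertex set `{P 0, …, P n}` of a path. -/
def VertsUpTo (n : ℕ) (P : ℕ → V) : Set V := {w | ∃ i ≤ n, P i = w}

/-- The odd-indexed vertices among `{P 0, …, P n}`. -/
def OddVertsUpTo (n : ℕ) (P : ℕ → V) : Set V := {w | ∃ i, i ≤ n ∧ Odd i ∧ P i = w}

/-- The even-indexed vertices among `{P 0, …, P n}`. -/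
def EvenVertsUpTo (n : ℕ) (P : ℕ → V) : Set V := {w | ∃ i, i ≤ n ∧ Even i ∧ P i = w}

/-- `I`: vertices outside `S` receiving no arc from `S`. -/
def ISet (A : V → V → Prop) (S : Set V) : Set V :=
  {x | x ∉ S ∧ ∀ w ∈ S, ¬ A w x}

/-- `W`: vertices outside `S` sending no arc to `S`. -/
def WSet (A : V → V → Prop) (S : Set V) : Set V :=
  {x | x ∉ S ∧ ∀ w ∈ S, ¬ A x w}

/-- `B`: vertices outside `S` that are in neither `I` nor `W`. -/
def BSet (A : V → V → Prop) (S : Set V) : Set V :=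
  {x | x ∉ S ∧ x ∉ ISet A S ∧ x ∉ WSet A S}

/-- A vertex off a directed path with an arc to its start can be prepended to it. -/
lemma IsDipathOn.cons {V : Type*} {A : V → V → Prop} {n : ℕ} {y : ℕ → V} {x : V}
    (hy : IsDipathOn A n y) (hx : A x (y 0)) (hyx : ∀ t ≤ n, y t ≠ x) :
    IsDipathOn A (n + 1) (fun t => if t = 0 then x else y (t - 1)) := by
  refine ⟨fun s t hs ht h => ?_, fun t ht => ?_⟩
  · by_cases hs0 : s = 0 <;> by_cases ht0 : t = 0 <;> simp only [hs0, ht0, if_true, if_false] at h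
    · omega
    · exact (hyx _ (by omega) h.symm).elim
    · exact (hyx _ (by omega) h).elim
    · have := hy.1 _ _ (by omega) (by omega) h
      omega
  · by_cases ht0 : t = 0
    · simpa [ht0] using hx
    · have := hy.2 (t - 1) (by omega)
      rw [Nat.sub_add_cancel (by omega)] at this
      simpa [ht0] using this

/-- A vertex off a directed path with an arc from its end can be appended to it. -/
lemma IsDipathOn.snoc {V : Type*} {A : V → V → Prop} {n : ℕ} {y : ℕ → V} {x : V}
    (hy : IsDipathOn A n y) (hx : A (y n) x) (hyx : ∀ t ≤ n, y t ≠ x) :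
    IsDipathOn A (n + 1) (fun t => if t ≤ n then y t else x) := by
  refine ⟨fun s t hs ht h => ?_, fun t ht => ?_⟩
  · by_cases hsn : s ≤ n <;> by_cases htn : t ≤ n <;> simp only [hsn, htn, if_true, if_false] at h
    · exact hy.1 _ _ hsn htn h
    · exact (hyx _ hsn h).elim
    · exact (hyx _ htn h.symm).elim
    · omega
  · rcases Nat.lt_or_ge t n with h | h
    · have h' : t + 1 ≤ n := h
      simpa [h.le, h'] using hy.2 t h
    · obtain rfl : t = n := by omega
      simpa using hx

/-- A shortest directed path has no forward chords. -/
lemma not_arc_of_shortest {V : Type*} {A : V → V → Prop} {n : ℕ} {P : ℕ → V}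
    (hdist : ∀ m, m < n → ¬ HasDipath A m (P 0) (P n)) (hP : IsDipathOn A n P)
    {a b : ℕ} (hba : b + 2 ≤ a) (ha : a ≤ n) : ¬ A (P b) (P a) := by
  intro h
  refine hdist (n - (a - b - 1)) (by omega)
    ⟨fun t => P (if t ≤ b then t else t + (a - b - 1)), ⟨?_, ?_⟩, by simp, ?_⟩
  · intro s t hs ht hst
    have := hP.1 _ _ (by split_ifs <;> omega) (by split_ifs <;> omega) hst
    split_ifs at this <;> omega
  · intro t ht
    rcases lt_trichotomy t b with htb | rfl | htb
    · have h' : t + 1 ≤ b := htb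
      simpa [htb.le, h'] using hP.2 t (by omega)
    · have e : t + 1 + (a - t - 1) = a := by omega
      simpa [e] using h
    · have h₁ : ¬ t ≤ b := by omega
      have h₂ : ¬ t + 1 ≤ b := by omega
      have := hP.2 (t + (a - b - 1)) (by omega)
      simp only [h₁, h₂, if_false]
      rwa [show t + 1 + (a - b - 1) = t + (a - b - 1) + 1 by omega]
  · have h₁ : ¬ n - (a - b - 1) ≤ b := by omega
    simp only [h₁, if_false]
    congr 1
    omega

/-- For `j < i ≤ k + 2`, one can travel from `i` to `j` through exactly `k` distinct numbers in
`{0, …, k + 2}`, each step either increasing by one or decreasing by at least two. -/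
lemma exists_backward_route {k i j : ℕ} (hk : 5 ≤ k) (hji : j < i) (hi : i ≤ k + 2) :
    ∃ f : ℕ → ℕ, f 0 = i ∧ f (k - 1) = j ∧ (∀ t ≤ k - 1, f t ≤ k + 2) ∧
      (∀ s t, s ≤ k - 1 → t ≤ k - 1 → f s = f t → s = t) ∧
      ∀ t < k - 1, f (t + 1) = f t + 1 ∨ f (t + 1) + 2 ≤ f t := by
  by_cases hm : i ≤ j + 4
  · -- the route `i, …, a, b, …, j`
    obtain ⟨a, b, hia, hak, hbj, hab⟩ :
        ∃ a b, i ≤ a ∧ a ≤ k + 2 ∧ b ≤ j ∧ a + j + 2 = b + k + i := by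
      by_cases h : i ≤ 4
      · exact ⟨k + i - 2, j, by omega, by omega, le_rfl, by omega⟩
      · exact ⟨k + 2, j + 4 - i, by omega, le_rfl, by omega, by omega⟩
    refine ⟨fun t => if t ≤ a - i then i + t else t + b - (a - i + 1), ?_, ?_, ?_, ?_, ?_⟩
    · simp
    · dsimp only
      split_ifs <;> omega
    · intro t ht
      dsimp only
      split_ifs <;> omega
    · intro s t hs ht h
      dsimp only at h
      split_ifs at h <;> omega
    · intro t ht
      dsimp only
      split_ifs <;> omega
  · -- the route `i, …, k + 2, j + 3, …, i - 2, 0, …, j`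
    refine ⟨fun t => if t < k + 3 - i then i + t else
      if t < k - 1 - j then t + i + j - k else t - (k - 1 - j), ?_, ?_, ?_, ?_, ?_⟩
    · dsimp only
      split_ifs <;> omega
    · dsimp only
      split_ifs <;> omega
    · intro t ht
      dsimp only
      split_ifs <;> omega
    · intro s t hs ht h
      dsimp only at h
      split_ifs at h <;> omega
    · intro t ht
      dsimp only
      split_ifs <;> omega

theorem stmt_7
    {V : Type*} [Fintype V] (A : V → V → Prop) (hirr : Irreflexive A)
    (k : ℕ) (hk5 : 5 ≤ k) (hkodd : Odd k)
    (hQT : KQuasiTransitive A k) (hstrong : StrongD A)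
    (u v : V) (hdist : ∀ m, m < k + 2 → ¬ HasDipath A m u v)
    (P : ℕ → V) (hP : IsDipathOn A (k + 2) P) (hPu : P 0 = u) (hPv : P (k + 2) = v)
    (hsemi : SemicompleteOn A (VertsUpTo (k + 2) P)) :
    ∀ x : V, x ∉ VertsUpTo (k + 2) P → ∀ i ≤ k + 2,
      (A x (P i) → ∀ j < i, DAdj A x (P j)) ∧
      (A (P i) x → ∀ j : ℕ, i < j → j ≤ k + 2 → DAdj A x (P j)) := by
  subst hPu hPv
  have hback : ∀ a b, b + 2 ≤ a → a ≤ k + 2 → A (P a) (P b) := by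
    intro a b hba ha
    have hne : P a ≠ P b := fun h => by
      have := hP.1 a b ha (by omega) h
      omega
    rcases hsemi _ ⟨a, ha, rfl⟩ _ ⟨b, by omega, rfl⟩ hne with h | h
    · exact h
    · exact (not_arc_of_shortest hdist hP hba ha h).elim
  intro x hx
  have key : ∀ i j, j < i → i ≤ k + 2 →
      ∃ y : ℕ → V, y 0 = P i ∧ y (k - 1) = P j ∧ IsDipathOn A (k - 1) y ∧
        ∀ t ≤ k - 1, y t ≠ x := by
    intro i j hji hi
    obtain ⟨f, h0, hlast, hle, hinj, hstep⟩ := exists_backward_route hk5 hji hi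
    refine ⟨fun t => P (f t), by simp [h0], by simp [hlast], ⟨?_, ?_⟩, ?_⟩
    · exact fun s t hs ht h => hinj s t hs ht (hP.1 _ _ (hle s hs) (hle t ht) h)
    · intro t ht
      rcases hstep t ht with h | h
      · have := hP.2 (f t) (by have := hle (t + 1) ht; omega)
        simpa only [h] using this
      · exact hback _ _ h (hle t ht.le)
    · exact fun t ht h => hx ⟨f t, hle t ht, h⟩
  obtain ⟨n, rfl⟩ : ∃ n, k = n + 1 := ⟨k - 1, by omega⟩
  refine fun i hi => ⟨fun hA j hji => ?_, fun hA j hij hj => ?_⟩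
  · obtain ⟨y, h0, hlast, hy, hyx⟩ := key i j hji hi
    rw [Nat.add_sub_cancel] at hlast
    have := hQT _ (hy.cons (by rwa [h0]) hyx)
    simpa [hlast] using this
  · obtain ⟨y, h0, hlast, hy, hyx⟩ := key j i hij hj
    rw [Nat.add_sub_cancel] at hlast
    have := hQT _ (hy.snoc (by simpa [hlast] using hA) hyx)
    simpa [h0, DAdj, or_comm] using this
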